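/- Let E be a measurable space, p ∈ (0,1), α a finite measure on E, and let φ : E → ℝ be bounded measurable. Define c(x,y) := 2φ(x)φ(y) and, for bounded measurable F : Conf(E) → ℂ, the generator (LF)(η) := ∑_{x∈η} (∫_E (F(η − x + y) − F(η)) c(x,y) α(dy) + ∑_{y∈η} (F(η − x + y) − F(η)) c(x,y)). Then for every bounded measurable F and every finite configuration η: (LF)(η) = (k⁺(φ)(k⁻(φ)F))(η) + (k⁻(φ)(k⁺(φ)F))(η) − 2 (k⁰(φ)(k⁰(φ)F))(η) + ((1/2)(∫_E φ dα)² − ∫_E φ² dα) F(η). -/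

import Mathlib

open MeasureTheory Complex

noncomputable section

variable {E : Type*}

/-- Number of points of the finite configuration `η` lying in `B`, counted with multiplicity. -/
def confCount (η : Multiset E) (B : Set E) : ℕ :=
  @Multiset.countP E (fun x => x ∈ B) (Classical.decPred _) η

/-- Removal of one copy of the point `x` from the configuration `η`. -/
def confDel (η : Multiset E) (x : E) : Multiset E :=
  @Multiset.erase E (Classical.decEq E) η x

/-- The σ-algebra on the configuration space generated by the counting maps `η ↦ η(B)`,
`B` measurable. -/
instance confMeasurableSpace [MeasurableSpace E] : MeasurableSpace (Multiset E) :=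
  MeasurableSpace.generateFrom
    {S | ∃ (B : Set E) (n : ℕ), MeasurableSet B ∧ S = {η | confCount η B = n}}

/-- The raising operator `k⁺(φ)`. -/
def kplus (p : ℝ) (φ : E → ℂ) (F : Multiset E → ℂ) (η : Multiset E) : ℂ :=
  (Real.sqrt p : ℂ)⁻¹ * (η.map (fun x => φ x * F (confDel η x))).sum

/-- The lowering operator `k⁻(φ)`. -/
def kminus (p : ℝ) [MeasurableSpace E] (α : Measure E) (φ : E → ℂ) (F : Multiset E → ℂ)
    (η : Multiset E) : ℂ :=
  (Real.sqrt p : ℂ) * ((∫ x, (starRingEnd ℂ) (φ x) * F (x ::ₘ η) ∂α) +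
    (η.map (fun x => (starRingEnd ℂ) (φ x) * F (x ::ₘ η))).sum)

/-- The neutral operator `k⁰(φ)`. -/
def kzero [MeasurableSpace E] (α : Measure E) (φ : E → ℂ) (F : Multiset E → ℂ)
    (η : Multiset E) : ℂ :=
  F η * ((η.map φ).sum + (1 / 2 : ℂ) * ∫ x, φ x ∂α)


theorem measurable_cons_configuration [MeasurableSpace E] (ξ : Multiset E) :
    Measurable (fun y : E => y ::ₘ ξ) := by
  classical
  refine measurable_generateFrom ?_
  rintro _ ⟨B, n, hB, rfl⟩
  have h : Measurable (fun y : E => confCount ξ B + if y ∈ B then 1 else 0) :=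
    measurable_const.add (Measurable.ite hB measurable_const measurable_const)
  convert h (measurableSet_singleton n) using 1
  ext y
  simp [confCount, Multiset.countP_cons]

theorem integrable_multiset_sum_map {X ι : Type*} [MeasurableSpace X] {μ : Measure X}
    (s : Multiset ι) {f : ι → X → ℂ} (hf : ∀ i, Integrable (f i) μ) :
    Integrable (fun x => (s.map (fun i => f i x)).sum) μ := by
  induction s using Multiset.induction_on with
  | empty => simp
  | cons a s ih =>
    simp only [Multiset.map_cons, Multiset.sum_cons]
    exact (hf a).add ih

theorem integral_multiset_sum_map {X ι : Type*} [MeasurableSpace X] {μ : Measure X}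
    (s : Multiset ι) {f : ι → X → ℂ} (hf : ∀ i, Integrable (f i) μ) :
    ∫ x, (s.map (fun i => f i x)).sum ∂μ = (s.map (fun i => ∫ x, f i x ∂μ)).sum := by
  induction s using Multiset.induction_on with
  | empty => simp
  | cons a s ih =>
    simp only [Multiset.map_cons, Multiset.sum_cons]
    rw [integral_add (hf a) (integrable_multiset_sum_map s hf), ih]

theorem cons_confDel {η : Multiset E} {x : E} (hx : x ∈ η) : x ::ₘ confDel η x = η := by
  classical
  unfold confDel
  convert Multiset.cons_erase hx

theorem confDel_cons_self (η : Multiset E) (x : E) : confDel (x ::ₘ η) x = η := by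
  simp [confDel]

theorem confDel_cons_of_mem {η : Multiset E} {z : E} (hz : z ∈ η) (x : E) :
    confDel (x ::ₘ η) z = x ::ₘ confDel η z := by
  rw [← Multiset.cons_inj_right z, cons_confDel (Multiset.mem_cons_of_mem hz),
    Multiset.cons_swap, cons_confDel hz]

theorem sum_map_confDel {η : Multiset E} {x : E} (hx : x ∈ η) (g : E → ℂ) :
    ((confDel η x).map g).sum = (η.map g).sum - g x := by
  conv_rhs => rw [← cons_confDel hx]
  simp

/-- Adding `x` before or after the removal of a point differs only by the term in which the
added point itself is removed. -/
theorem sum_map_cons_confDel (φ : E → ℂ) (F : Multiset E → ℂ) (η : Multiset E) (x : E) :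
    ((x ::ₘ η).map (fun z => φ z * F (confDel (x ::ₘ η) z))).sum
      = φ x * F η + (η.map (fun z => φ z * F (x ::ₘ confDel η z))).sum := by
  rw [Multiset.map_cons, Multiset.sum_cons, confDel_cons_self]
  congr 2
  exact Multiset.map_congr rfl fun z hz => by rw [confDel_cons_of_mem hz]

/-- the generator of the generalized symmetric inclusion process with rates
`c(x,y) = 2 φ(x) φ(y)` expressed through the raising, lowering and neutral operators. -/
theorem generator_algebraic [MeasurableSpace E] (p : ℝ) (hp : p ∈ Set.Ioo (0 : ℝ) 1)
    (α : Measure E) [IsFiniteMeasure α]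
    (φ : E → ℝ) (hφ : Measurable φ) (hφb : ∃ C, ∀ x, |φ x| ≤ C)
    (c : E → E → ℝ) (hc : ∀ x y, c x y = 2 * φ x * φ y)
    (F : Multiset E → ℂ) (hF : Measurable F) (hFb : ∃ C, ∀ η, ‖F η‖ ≤ C)
    (L : (Multiset E → ℂ) → Multiset E → ℂ)
    (hL : ∀ (G : Multiset E → ℂ) (η : Multiset E),
      L G η = (η.map (fun x =>
        (∫ y, (G (y ::ₘ confDel η x) - G η) * (c x y : ℂ) ∂α) +
          (η.map (fun y => (G (y ::ₘ confDel η x) - G η) * (c x y : ℂ))).sum)).sum)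
    (η : Multiset E) :
    L F η
      = kplus p (fun x => (φ x : ℂ)) (kminus p α (fun x => (φ x : ℂ)) F) η
        + kminus p α (fun x => (φ x : ℂ)) (kplus p (fun x => (φ x : ℂ)) F) η
        - 2 * kzero α (fun x => (φ x : ℂ)) (kzero α (fun x => (φ x : ℂ)) F) η
        + (((1 / 2 : ℝ) * (∫ x, φ x ∂α) ^ 2 - ∫ x, (φ x) ^ 2 ∂α : ℝ) : ℂ) * F η := by
  have hs : (Real.sqrt p : ℂ) ≠ 0 := by
    exact_mod_cast (Real.sqrt_pos.2 hp.1).ne'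
  obtain ⟨C, hC⟩ := hφb
  obtain ⟨D, hD⟩ := hFb
  have hφc : Measurable (fun x => (φ x : ℂ)) := measurable_ofReal.comp hφ
  have hφi : Integrable (fun x => (φ x : ℂ)) α :=
    Integrable.of_bound hφc.aestronglyMeasurable C (.of_forall fun x => by simpa using hC x)
  have hφF : ∀ ξ, Integrable (fun y => (φ y : ℂ) * F (y ::ₘ ξ)) α := fun ξ =>
    hφi.mul_bdd (hF.comp (measurable_cons_configuration ξ)).aestronglyMeasurable
      (.of_forall fun y => hD (y ::ₘ ξ))
  have hφφ : Integrable (fun x => (φ x : ℂ) * φ x) α :=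
    hφi.mul_bdd hφc.aestronglyMeasurable (.of_forall fun x => by simpa using hC x)
  set I : ℂ := ∫ x, (φ x : ℂ) ∂α with hI
  set S : ℂ := (η.map (fun x => (φ x : ℂ))).sum with hS
  set A : E → ℂ := fun x => ∫ y, (φ y : ℂ) * F (y ::ₘ confDel η x) ∂α with hA
  set B : E → ℂ := fun x => (η.map (fun y => (φ y : ℂ) * F (y ::ₘ confDel η x))).sum with hB
  set Q : ℂ := (η.map (fun x => (φ x : ℂ) * φ x)).sum with hQ
  set J : ℂ := ∫ x, (φ x : ℂ) * φ x ∂α with hJ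
  have hLF : L F η = 2 * (η.map (fun x => φ x * A x)).sum
      + 2 * (η.map (fun x => φ x * B x)).sum - 2 * F η * (S * I + S ^ 2) := by
    have key : ∀ x, (∫ y, (F (y ::ₘ confDel η x) - F η) * (c x y : ℂ) ∂α) +
          (η.map (fun y => (F (y ::ₘ confDel η x) - F η) * (c x y : ℂ))).sum
        = 2 * (φ x * A x) + 2 * (φ x * B x) - φ x * (2 * F η * (I + S)) := by
      intro x
      have e : ∀ y, (F (y ::ₘ confDel η x) - F η) * (c x y : ℂ)
          = 2 * φ x * (φ y * F (y ::ₘ confDel η x)) - 2 * φ x * F η * φ y := by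
        intro y
        rw [hc]
        push_cast
        ring
      simp only [e]
      rw [integral_sub ((hφF _).const_mul _) (hφi.const_mul _), integral_const_mul,
        integral_const_mul, Multiset.sum_map_sub, Multiset.sum_map_mul_left,
        Multiset.sum_map_mul_left]
      simp only [hA, hB, hI, hS]
      ring
    rw [hL]
    simp only [key]
    rw [Multiset.sum_map_sub, Multiset.sum_map_add, Multiset.sum_map_mul_left,
      Multiset.sum_map_mul_left, Multiset.sum_map_mul_right]
    ring
  have hpm : kplus p (fun x => (φ x : ℂ)) (kminus p α (fun x => (φ x : ℂ)) F) η
      = (η.map (fun x => φ x * A x)).sum + (η.map (fun x => φ x * B x)).sum - Q * F η := by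
    rw [kplus, hQ, ← Multiset.sum_map_mul_right, ← Multiset.sum_map_add, ← Multiset.sum_map_sub,
      ← Multiset.sum_map_mul_left]
    refine congrArg _ (Multiset.map_congr rfl fun x hx => ?_)
    simp only [kminus, conj_ofReal]
    rw [sum_map_confDel hx, cons_confDel hx]
    simp only [hA, hB]
    field_simp
    ring
  have hmp : kminus p α (fun x => (φ x : ℂ)) (kplus p (fun x => (φ x : ℂ)) F) η
      = J * F η + (η.map (fun x => φ x * A x)).sum + Q * F η
        + (η.map (fun x => φ x * B x)).sum := by
    have e : ∀ x, (φ x : ℂ) * kplus p (fun x => (φ x : ℂ)) F (x ::ₘ η)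
        = (Real.sqrt p : ℂ)⁻¹ * (φ x * φ x * F η
          + (η.map (fun z => φ z * (φ x * F (x ::ₘ confDel η z)))).sum) := by
      intro x
      rw [kplus, sum_map_cons_confDel (fun x => (φ x : ℂ))]
      simp only [mul_left_comm _ (φ x : ℂ), Multiset.sum_map_mul_left]
      ring
    simp only [kminus, conj_ofReal, e]
    rw [integral_const_mul, Multiset.sum_map_mul_left, ← mul_add, mul_inv_cancel_left₀ hs,
      integral_add (hφφ.mul_const _)
        (integrable_multiset_sum_map η fun z => (hφF (confDel η z)).const_mul _),
      integral_mul_const, integral_multiset_sum_map η fun z => (hφF (confDel η z)).const_mul _,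
      Multiset.sum_map_add, Multiset.sum_map_mul_right, Multiset.sum_map_sum_map]
    simp only [integral_const_mul, Multiset.sum_map_mul_left, hA, hB]
    ring
  have hIr : ((∫ x, φ x ∂α : ℝ) : ℂ) = I := integral_ofReal.symm
  have hJr : ((∫ x, φ x ^ 2 ∂α : ℝ) : ℂ) = J := by
    rw [← integral_complex_ofReal]
    simp only [hJ, sq, ofReal_mul]
  rw [hLF, hpm, hmp]
  simp only [kzero]
  push_cast
  rw [hIr, hJr]
  ring
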